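/- Let $k$ be a field. A category with duality over $k$ is a $k$-linear category $\mathcal C$ with a $k$-linear contravariant endofunctor $(-)^\vee$ and a natural transformation $j:\mathrm{id}_{\mathcal C}\to(-)^{\vee\vee}$ such that $(j_X)^\vee\circ j_{X^\vee}=\mathrm{id}_{X^\vee}$ for all $X$; it is strong if $j$ is an isomorphism. A $k$-linear twisting adjunction for $\mathcal C$ is a quintuple $\mathbf t=(F,G,\eta,\varepsilon,\xi)$ in which $F\dashv G$ is an adjunction from $\mathcal C$ to itself with unit $\eta:\mathrm{id}\to GF$ and counit $\varepsilon:FG\to\mathrm{id}$, the functor $F$ is $k$-linear, and $\xi_X:F(X^\vee)\to G(X)^\vee$ is a natural transformation such that, with $\zeta_X:=F(j_X)^\vee\circ\xi_{X^\vee}^\vee\circ j_{G(X^\vee)}$, one has $\eta_X^\vee\circ\xi_{F(X)}\circ F(\zeta_X)=\varepsilon_{X^\vee}$ for all $X$. A nonzero object of an Abelian category is simple if it has no proper nonzero subobjects; it is absolutely simple if in addition the canonical map $k\to\mathrm{End}_{\mathcal C}(X)$ is bijective. Let $\mathcal C$ be an Abelian category with strong duality over $k$, all of whose Hom-spaces are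 finite-dimensional over $k$, and let $\mathbf t=(F,G,\eta,\varepsilon,\xi)$ be a $k$-linear twisting adjunction for $\mathcal C$ such that $F$ is an equivalence of categories. Define the $\mathbf t$-twisted FS indicator $\nu^{\mathbf t}(X)$ of an object $X$ as the trace of the $k$-linear endomorphism $T^{\mathbf t}_{X,X}$ of $\mathrm{Hom}_{\mathcal C}(F(X),X^\vee)$ given by $T^{\mathbf t}_{X,X}(f)=\eta_X^\vee\circ\xi_{F(X)}\circ F(f^\vee\circ j_X)$. Then: (a) if $X$ is a finite biproduct of simple objects, then $\nu^{\mathbf t}(G(X))=\nu^{\mathbf t}(X^\vee)$; (b) if $X$ is absolutely simple and $\operatorname{char} k\neq 2$, then $\nu^{\mathbf t}(X)\in\{0,+1,-1\}$, and $\nu^{\mathbf t}(X)\neq 0$ if and only if $F(X)$ is isomorphic to $X^\vee$. -/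

import Mathlib

open CategoryTheory CategoryTheory.Limits

attribute [local instance] CategoryTheory.Limits.HasFiniteBiproducts.of_hasFiniteProducts

universe v u w

/-- A category with duality: a contravariant endofunctor `(dObj, dMap)` together with a
pivotal morphism `j : id → (−)^∨∨` satisfying `(j_X)^∨ ∘ j_{X^∨} = id`. -/
structure DualityStruct (C : Type u) [Category.{v} C] where
  dObj : C → C
  dMap : ∀ {X Y : C}, (X ⟶ Y) → (dObj Y ⟶ dObj X)
  dMap_id : ∀ X : C, dMap (𝟙 X) = 𝟙 (dObj X)
  dMap_comp : ∀ {X Y Z : C} (f : X ⟶ Y) (g : Y ⟶ Z), dMap (f ≫ g) = dMap g ≫ dMap f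
  j : ∀ X : C, X ⟶ dObj (dObj X)
  j_natural : ∀ {X Y : C} (f : X ⟶ Y), f ≫ j Y = j X ≫ dMap (dMap f)
  coherence : ∀ X : C, j (dObj X) ≫ dMap (j X) = 𝟙 (dObj X)

/-- The duality is strong if the pivotal morphism is a natural isomorphism. -/
def DualityStruct.IsStrong {C : Type u} [Category.{v} C] (dd : DualityStruct C) : Prop :=
  ∀ X : C, IsIso (dd.j X)

/-- A category with duality over a field `k`: the ambient category is `k`-linear and the
duality functor is `k`-linear. -/
structure LinearDualityStruct (k : Type w) [Field k] (C : Type u) [Category.{v} C]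
    [Preadditive C] [CategoryTheory.Linear k C] extends DualityStruct C where
  dMap_add : ∀ {X Y : C} (f g : X ⟶ Y), dMap (f + g) = dMap f + dMap g
  dMap_smul : ∀ {X Y : C} (c : k) (f : X ⟶ Y), dMap (c • f) = c • dMap f

/-- The natural transformation `ζ_X = F(j_X)^∨ ∘ ξ^∨_{X^∨} ∘ j_{G(X^∨)} : G(X^∨) → F(X)^∨`. -/
def zeta {C : Type u} [Category.{v} C] (dd : DualityStruct C) (F G : C ⥤ C)
    (ξ : ∀ X : C, F.obj (dd.dObj X) ⟶ dd.dObj (G.obj X)) (X : C) :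
    G.obj (dd.dObj X) ⟶ dd.dObj (F.obj X) :=
  dd.j (G.obj (dd.dObj X)) ≫ dd.dMap (ξ (dd.dObj X)) ≫ dd.dMap (F.map (dd.j X))

/-- A twisting adjunction `(F, G, η, ε, ξ)`: an adjunction `F ⊣ G` (with unit `η` and counit
`ε`) and a natural transformation `ξ_X : F(X^∨) → G(X)^∨` such that
`η_X^∨ ∘ ξ_{F(X)} ∘ F(ζ_X) = ε_{X^∨}`. -/
structure TwistingAdjunction {C : Type u} [Category.{v} C] (dd : DualityStruct C) where
  F : C ⥤ C
  G : C ⥤ C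
  adj : F ⊣ G
  ξ : ∀ X : C, F.obj (dd.dObj X) ⟶ dd.dObj (G.obj X)
  ξ_natural : ∀ {X Y : C} (f : X ⟶ Y),
    F.map (dd.dMap f) ≫ ξ X = ξ Y ≫ dd.dMap (G.map f)
  twisting : ∀ X : C,
    F.map (zeta dd F G ξ X) ≫ ξ (F.obj X) ≫ dd.dMap (adj.unit.app X) =
      adj.counit.app (dd.dObj X)

/-- The twisted transposition map
`T^t_{X,X} : Hom(F(X), X^∨) → Hom(F(X), X^∨)`, `f ↦ η_X^∨ ∘ ξ_{F(X)} ∘ F(f^∨ ∘ j_X)`,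
as a `k`-linear map. -/
def twTransHom {k : Type w} [Field k] {C : Type u} [Category.{v} C]
    [Preadditive C] [CategoryTheory.Linear k C] (dd : LinearDualityStruct k C)
    (t : TwistingAdjunction dd.toDualityStruct) [t.F.Additive] [t.F.Linear k] (X : C) :
    (t.F.obj X ⟶ dd.dObj X) →ₗ[k] (t.F.obj X ⟶ dd.dObj X) where
  toFun f := t.F.map (dd.j X ≫ dd.dMap f) ≫ t.ξ (t.F.obj X) ≫ dd.dMap (t.adj.unit.app X)
  map_add' f g := by
    rw [dd.dMap_add, Preadditive.comp_add, t.F.map_add, Preadditive.add_comp]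
  map_smul' c f := by
    rw [dd.dMap_smul, CategoryTheory.Linear.comp_smul, t.F.map_smul,
      CategoryTheory.Linear.smul_comp, RingHom.id_apply]

/-- The `t`-twisted Frobenius–Schur indicator `ν^t(X)`: the trace of the twisted
transposition map `T^t_{X,X}`. -/
noncomputable def nuT {k : Type w} [Field k] {C : Type u} [Category.{v} C]
    [Preadditive C] [CategoryTheory.Linear k C] (dd : LinearDualityStruct k C)
    (t : TwistingAdjunction dd.toDualityStruct) [t.F.Additive] [t.F.Linear k] (X : C) : k :=
  LinearMap.trace k (t.F.obj X ⟶ dd.dObj X) (twTransHom dd t X)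

/-- `X` is a finite biproduct of simple objects. -/
def IsFiniteBiproductOfSimples {C : Type u} [Category.{v} C] [Abelian C] (X : C) : Prop :=
  ∃ (n : ℕ) (V : Fin n → C), (∀ i, Simple (V i)) ∧ Nonempty (X ≅ ⨁ V)

/-- `X` is absolutely simple: simple, with `k → End(X)` bijective. -/
def IsAbsolutelySimple (k : Type w) [Field k] {C : Type u} [Category.{v} C]
    [Preadditive C] [CategoryTheory.Linear k C] (X : C) : Prop :=
  Simple X ∧ Function.Bijective (fun c : k => (c • 𝟙 X : X ⟶ X))

namespace DualityStruct

variable {C : Type u} [Category.{v} C] (dd : DualityStruct C)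

lemma isIso_dMap {X Y : C} (f : X ⟶ Y) [IsIso f] : IsIso (dd.dMap f) :=
  ⟨dd.dMap (inv f), by rw [← dd.dMap_comp, IsIso.inv_hom_id, dd.dMap_id],
    by rw [← dd.dMap_comp, IsIso.hom_inv_id, dd.dMap_id]⟩

/-- The adjunct `f ↦ f^∨ ∘ j_Y` of a morphism `f : X ⟶ Y^∨` recovers every `y : Y ⟶ X^∨`. -/
lemma j_comp_dMap_j_comp_dMap {X Y : C} (y : Y ⟶ dd.dObj X) :
    dd.j Y ≫ dd.dMap (dd.j X ≫ dd.dMap y) = y := by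
  rw [dd.dMap_comp, ← Category.assoc, ← dd.j_natural, Category.assoc, dd.coherence,
    Category.comp_id]

end DualityStruct

namespace TwistingAdjunction

section General

variable {C : Type u} [Category.{v} C] {dd : DualityStruct C} (t : TwistingAdjunction dd)

/-- The canonical morphism `η_X^∨ ∘ ξ_{F(X)} : F(F(X)^∨) ⟶ X^∨`. -/
def dualCounit (X : C) : t.F.obj (dd.dObj (t.F.obj X)) ⟶ dd.dObj X :=
  t.ξ (t.F.obj X) ≫ dd.dMap (t.adj.unit.app X)

lemma dualCounit_natural {X Y : C} (f : X ⟶ Y) :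
    t.F.map (dd.dMap (t.F.map f)) ≫ t.dualCounit X = t.dualCounit Y ≫ dd.dMap f := by
  unfold dualCounit
  rw [← Category.assoc, t.ξ_natural, Category.assoc, Category.assoc, ← dd.dMap_comp,
    ← dd.dMap_comp]
  congr 2
  exact (t.adj.unit.naturality f).symm

/-- The twisted transposition `Hom(F(X), Y^∨) → Hom(F(Y), X^∨)`. -/
def transpose {X Y : C} (f : t.F.obj X ⟶ dd.dObj Y) : t.F.obj Y ⟶ dd.dObj X :=
  t.F.map (dd.j Y ≫ dd.dMap f) ≫ t.dualCounit X

lemma j_comp_dMap_transpose {X Y : C} (f : t.F.obj X ⟶ dd.dObj Y) :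
    dd.j X ≫ dd.dMap (t.transpose f) =
      t.adj.unit.app X ≫ t.G.map f ≫ zeta dd t.F t.G t.ξ Y := by
  have h : t.transpose f = t.F.map (dd.j Y) ≫ t.ξ (dd.dObj Y) ≫ dd.dMap (t.G.map f) ≫
      dd.dMap (t.adj.unit.app X) := by
    unfold transpose dualCounit
    rw [t.F.map_comp, Category.assoc, ← Category.assoc (t.F.map (dd.dMap f)), t.ξ_natural,
      Category.assoc]
  rw [h, dd.dMap_comp, dd.dMap_comp, dd.dMap_comp]
  simp only [Category.assoc]
  rw [← Category.assoc, ← dd.j_natural]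
  simp only [Category.assoc]
  rw [← Category.assoc (dd.j _), ← dd.j_natural]
  simp only [Category.assoc, zeta, Functor.id_obj, Functor.comp_obj]

/-- Twisted transposition is involutive. -/
lemma transpose_transpose {X Y : C} (f : t.F.obj X ⟶ dd.dObj Y) :
    t.transpose (t.transpose f) = f := by
  have h := t.twisting Y
  change t.F.map (dd.j X ≫ dd.dMap (t.transpose f)) ≫ t.dualCounit Y = f
  rw [j_comp_dMap_transpose, t.F.map_comp, t.F.map_comp, Category.assoc, Category.assoc,
    dualCounit, h, t.adj.counit_naturality, t.adj.left_triangle_components_assoc]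

lemma transpose_natural {X X' Y Y' : C} (a : X' ⟶ X) (b : Y' ⟶ Y)
    (f : t.F.obj X ⟶ dd.dObj Y) :
    t.transpose (t.F.map a ≫ f ≫ dd.dMap b) = t.F.map b ≫ t.transpose f ≫ dd.dMap a := by
  unfold transpose
  rw [Category.assoc, ← t.dualCounit_natural, dd.dMap_comp, dd.dMap_comp]
  simp only [← t.F.map_comp, ← Category.assoc]
  rw [dd.j_natural]

/-- Post-composition with `dualCounit` is injective on morphisms in the image of `F`. -/
lemma map_comp_dualCounit_injective {X Y : C} {y z : Y ⟶ dd.dObj (t.F.obj X)}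
    (h : t.F.map y ≫ t.dualCounit X = t.F.map z ≫ t.dualCounit X) : y = z := by
  have h' : t.transpose (dd.j _ ≫ dd.dMap y) = t.transpose (dd.j _ ≫ dd.dMap z) := by
    unfold transpose
    rwa [dd.j_comp_dMap_j_comp_dMap, dd.j_comp_dMap_j_comp_dMap]
  have h'' := congrArg t.transpose h'
  rw [transpose_transpose, transpose_transpose] at h''
  rw [← dd.j_comp_dMap_j_comp_dMap y, h'', dd.j_comp_dMap_j_comp_dMap]

lemma isIso_dualCounit [t.F.IsEquivalence] (X : C) : IsIso (t.dualCounit X) := by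
  have : t.G.IsEquivalence := t.adj.isEquivalence_right_of_isEquivalence_left
  let s : dd.dObj X ⟶ _ := inv (t.adj.counit.app (dd.dObj X)) ≫ t.F.map (zeta dd t.F t.G t.ξ X)
  have hs : s ≫ t.dualCounit X = 𝟙 _ := by
    have h := t.twisting X
    simp only [s, dualCounit, Category.assoc]
    rw [h, IsIso.inv_hom_id]
  refine ⟨s, ?_, hs⟩
  obtain ⟨y, hy⟩ := t.F.map_surjective (t.dualCounit X ≫ s)
  rw [← hy, t.map_comp_dualCounit_injective (y := y) (z := 𝟙 _), t.F.map_id]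
  rw [hy, Category.assoc, hs, t.F.map_id, Category.comp_id, Category.id_comp]

/-- If `F` is an equivalence, then `ξ` is invertible. -/
lemma isIso_ξ [t.F.IsEquivalence] (X : C) : IsIso (t.ξ X) := by
  have : t.G.IsEquivalence := t.adj.isEquivalence_right_of_isEquivalence_left
  have h1 : ∀ Y : C, IsIso (t.ξ (t.F.obj Y)) := fun Y => by
    have := dd.isIso_dMap (t.adj.unit.app Y)
    have : IsIso (t.ξ (t.F.obj Y) ≫ dd.dMap (t.adj.unit.app Y)) := t.isIso_dualCounit Y
    exact IsIso.of_isIso_comp_right (t.ξ (t.F.obj Y)) (dd.dMap (t.adj.unit.app Y))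
  have h2 : t.F.map (dd.dMap (t.adj.counit.app X)) ≫ t.ξ (t.F.obj (t.G.obj X)) =
    t.ξ X ≫ dd.dMap (t.G.map (t.adj.counit.app X)) := t.ξ_natural (t.adj.counit.app X)
  have := h1 (t.G.obj X)
  have i1 := dd.isIso_dMap (t.adj.counit.app X)
  have i2 := dd.isIso_dMap (t.G.map (t.adj.counit.app X))
  have i3 : IsIso (t.ξ X ≫ dd.dMap (t.G.map (t.adj.counit.app X))) := by
    rw [← h2]
    infer_instance
  exact IsIso.of_isIso_comp_right _ (dd.dMap (t.G.map (t.adj.counit.app X)))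

/-- Transposition on `Hom(F(G(V)), G(V)^∨)`, in terms of morphisms `V ⟶ G(V)^∨`. -/
lemma transpose_counit_comp (V : C) (a : V ⟶ dd.dObj (t.G.obj V)) :
    t.transpose (X := t.G.obj V) (t.adj.counit.app V ≫ a) =
      t.F.map (dd.j _ ≫ dd.dMap a) ≫ t.ξ V := by
  unfold transpose dualCounit
  rw [dd.dMap_comp, t.F.map_comp, t.F.map_comp, t.F.map_comp]
  simp only [Category.assoc]
  rw [← Category.assoc (t.F.map (dd.dMap (t.adj.counit.app V)))]
  have h3 : t.F.map (dd.dMap (t.adj.counit.app V)) ≫ t.ξ (t.F.obj (t.G.obj V)) =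
    t.ξ V ≫ dd.dMap (t.G.map (t.adj.counit.app V)) := t.ξ_natural (t.adj.counit.app V)
  rw [h3, Category.assoc, ← dd.dMap_comp, t.adj.right_triangle_components, dd.dMap_id,
    Category.comp_id]

lemma map_j_comp_dMap_ξ_comp_dualCounit (V : C) :
    t.F.map (dd.j (t.G.obj V) ≫ dd.dMap (t.ξ V)) ≫ t.dualCounit (dd.dObj V) =
      t.adj.counit.app V ≫ dd.j V := by
  have h : t.adj.counit.app V ≫ dd.j V =
      t.F.map (t.G.map (dd.j V)) ≫ t.adj.counit.app (dd.dObj (dd.dObj V)) :=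
    (t.adj.counit_naturality (dd.j V)).symm
  rw [h, ← t.twisting, ← Category.assoc (t.F.map (t.G.map (dd.j V))), ← t.F.map_comp]
  congr 2
  unfold zeta
  rw [← Category.assoc, dd.j_natural, Category.assoc, ← Category.assoc (dd.dMap (dd.dMap _)),
    ← dd.dMap_comp, ← t.ξ_natural, dd.dMap_comp, Category.assoc, ← dd.dMap_comp,
    ← t.F.map_comp, dd.coherence, t.F.map_id, dd.dMap_id, Category.comp_id]

/-- Transposition on `Hom(F(V^∨), V^∨∨)`, in terms of morphisms `G(V)^∨ ⟶ V`. -/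
lemma transpose_ξ_comp (V : C) [IsIso (dd.j (t.G.obj V))] (b : dd.dObj (t.G.obj V) ⟶ V) :
    t.transpose (X := dd.dObj V) (t.ξ V ≫ b ≫ dd.j V) =
      t.F.map (dd.dMap b ≫ inv (dd.j (t.G.obj V))) ≫ t.adj.counit.app V ≫ dd.j V := by
  rw [← t.map_j_comp_dMap_ξ_comp_dualCounit, ← Category.assoc (t.F.map _) (t.F.map _),
    ← t.F.map_comp]
  unfold transpose
  congr 2
  rw [dd.dMap_comp, dd.dMap_comp]
  simp only [Category.assoc, IsIso.inv_hom_id_assoc]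
  rw [← Category.assoc, dd.coherence, Category.id_comp]

end General

section Indicator

variable {k : Type w} [Field k] {C : Type u} [Category.{v} C] [Preadditive C]
  [CategoryTheory.Linear k C] (dd : LinearDualityStruct k C)
  (t : TwistingAdjunction dd.toDualityStruct)

lemma dMap_zero (X Y : C) : dd.dMap (0 : X ⟶ Y) = 0 := by
  simpa using dd.dMap_smul (0 : k) (0 : X ⟶ Y)

lemma dMap_sum {ι : Type*} (s : Finset ι) {X Y : C} (f : ι → (X ⟶ Y)) :
    dd.dMap (∑ i ∈ s, f i) = ∑ i ∈ s, dd.dMap (f i) :=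
  map_sum (AddMonoidHom.mk' (fun f : X ⟶ Y => dd.dMap f) dd.dMap_add) f s

/-- The linear map `Hom(F(X), X^∨) → Hom(F(Y), Y^∨)` induced by `a b : Y ⟶ X`. -/
def pullForm {X Y : C} (a b : Y ⟶ X) :
    (t.F.obj X ⟶ dd.dObj X) →ₗ[k] (t.F.obj Y ⟶ dd.dObj Y) where
  toFun f := t.F.map a ≫ f ≫ dd.dMap b
  map_add' f g := by simp
  map_smul' c f := by simp

lemma pullForm_comp {X Y Z : C} (a b : Y ⟶ X) (a' b' : Z ⟶ Y) :
    pullForm dd t a' b' ∘ₗ pullForm dd t a b = pullForm dd t (a' ≫ a) (b' ≫ b) := by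
  ext f
  simp [pullForm, dd.dMap_comp]

variable [t.F.Additive] [t.F.Linear k]

lemma twTransHom_apply {X : C} (f : t.F.obj X ⟶ dd.dObj X) :
    twTransHom dd t X f = t.transpose f := rfl

lemma twTransHom_comp_pullForm {X Y : C} (a b : Y ⟶ X) :
    twTransHom dd t Y ∘ₗ pullForm dd t a b = pullForm dd t b a ∘ₗ twTransHom dd t X := by
  ext f
  exact t.transpose_natural a b f

/-- The indicator is additive along a decomposition of the identity into orthogonal
retracts. -/
lemma nuT_eq_sum [∀ X Y : C, FiniteDimensional k (X ⟶ Y)] {ι : Type*} [Fintype ι]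
    [DecidableEq ι] {X : C} (V : ι → C) (i : ∀ a, V a ⟶ X) (p : ∀ a, X ⟶ V a)
    (hip : ∀ a, i a ≫ p a = 𝟙 (V a)) (hne : ∀ a b, a ≠ b → i a ≫ p b = 0)
    (hsum : ∑ a, p a ≫ i a = 𝟙 X) :
    nuT dd t X = ∑ a, nuT dd t (V a) := by
  set T := twTransHom dd t X
  have hone : (LinearMap.id : _ →ₗ[k] (t.F.obj X ⟶ dd.dObj X)) =
      ∑ a, ∑ b, pullForm dd t (p a ≫ i a) (p b ≫ i b) := by
    ext f
    simp only [LinearMap.coe_sum, Finset.sum_apply, LinearMap.id_apply]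
    change f = ∑ a, ∑ b, t.F.map (p a ≫ i a) ≫ f ≫ dd.dMap (p b ≫ i b)
    simp only [← Preadditive.comp_sum, ← Preadditive.sum_comp, ← dMap_sum, ← t.F.map_sum, hsum,
      t.F.map_id, dd.dMap_id, Category.comp_id, Category.id_comp]
  have hoff : ∀ a b, a ≠ b →
      LinearMap.trace k _ (T ∘ₗ pullForm dd t (p a ≫ i a) (p b ≫ i b)) = 0 := by
    intro a b hab
    have hid : pullForm dd t (p a ≫ i a) (p b ≫ i b) =
        pullForm dd t (p a ≫ i a) (p b ≫ i b) ∘ₗ pullForm dd t (p a ≫ i a) (p b ≫ i b) := by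
      rw [pullForm_comp]
      congr 1
      · rw [Category.assoc, ← Category.assoc (i a), hip, Category.id_comp]
      · rw [Category.assoc, ← Category.assoc (i b), hip, Category.id_comp]
    rw [hid, ← LinearMap.comp_assoc, LinearMap.trace_comp_comm', twTransHom_comp_pullForm,
      ← LinearMap.comp_assoc, pullForm_comp]
    have h0 : pullForm dd t ((p a ≫ i a) ≫ p b ≫ i b) ((p b ≫ i b) ≫ p a ≫ i a) = 0 := by
      ext f
      have : (p a ≫ i a) ≫ p b ≫ i b = 0 := by
        rw [Category.assoc, ← Category.assoc (i a), hne a b hab, zero_comp, comp_zero]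
      simp [pullForm, this]
    rw [h0, LinearMap.zero_comp, map_zero]
  have hdiag : ∀ a, LinearMap.trace k _ (T ∘ₗ pullForm dd t (p a ≫ i a) (p a ≫ i a)) =
      nuT dd t (V a) := by
    intro a
    rw [← pullForm_comp, ← LinearMap.comp_assoc, twTransHom_comp_pullForm,
      LinearMap.trace_comp_comm', ← LinearMap.comp_assoc, pullForm_comp, hip]
    have h1 : pullForm dd t (𝟙 (V a)) (𝟙 (V a)) = LinearMap.id := by
      ext f
      simp [pullForm, dd.dMap_id]
    rw [h1, LinearMap.id_comp]
    rfl
  calc nuT dd t X = LinearMap.trace k _ (T ∘ₗ LinearMap.id) := rfl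
    _ = ∑ a, ∑ b, LinearMap.trace k _ (T ∘ₗ pullForm dd t (p a ≫ i a) (p b ≫ i b)) := by
      rw [hone]
      simp only [← Module.End.mul_eq_comp, Finset.mul_sum, map_sum]
    _ = ∑ a, nuT dd t (V a) := by
      refine Finset.sum_congr rfl fun a _ => ?_
      rw [Finset.sum_eq_single a (fun b _ hb => hoff a b hb.symm) (by simp), hdiag]

/-- A transposition-eigenvector `f₀ : F(G(V)) ≅ G(V)^∨` of eigenvalue `±1` forces the
indicators of `G(V)` and `V^∨` to agree. -/
lemma nuT_G_eq_of_eigenvector (hstrong : dd.toDualityStruct.IsStrong) [t.F.IsEquivalence]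
    (V : C) (a₀ : V ⟶ dd.dObj (t.G.obj V)) [IsIso a₀] (s : k) (hs : s * s = 1)
    (h₀ : t.F.map (dd.j _ ≫ dd.dMap a₀) ≫ t.ξ V = s • t.adj.counit.app V ≫ a₀) :
    nuT dd t (t.G.obj V) = nuT dd t (dd.dObj V) := by
  have : t.G.IsEquivalence := t.adj.isEquivalence_right_of_isEquivalence_left
  have := t.isIso_ξ V
  have := hstrong V
  have := hstrong (t.G.obj V)
  have := dd.isIso_dMap a₀
  let U := t.G.obj V
  have hinv : t.ξ V ≫ inv a₀ =
      s • t.F.map (inv (dd.dMap a₀) ≫ inv (dd.j U)) ≫ t.adj.counit.app V := by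
    have h1 : t.ξ V = t.F.map (inv (dd.dMap a₀) ≫ inv (dd.j U)) ≫
        (s • t.adj.counit.app V ≫ a₀) := by
      rw [← h₀, ← Category.assoc, ← t.F.map_comp]
      simp [U]
    rw [h1]
    simp
  let e : (t.F.obj U ⟶ dd.dObj U) ≃ₗ[k]
      (t.F.obj (dd.dObj V) ⟶ dd.dObj (dd.dObj V)) :=
    { toFun f := t.ξ V ≫ (inv a₀ ≫ inv (t.adj.counit.app V) ≫ f ≫ inv a₀) ≫ dd.j V
      map_add' f g := by simp
      map_smul' c f := by simp
      invFun h := t.adj.counit.app V ≫ a₀ ≫ inv (t.ξ V) ≫ h ≫ inv (dd.j V) ≫ a₀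
      left_inv f := by simp
      right_inv h := by simp }
  have hconj : e.conj (twTransHom dd t U) = twTransHom dd t (dd.dObj V) := by
    rw [LinearEquiv.conj_apply]
    refine (LinearEquiv.comp_toLinearMap_symm_eq _ _).2 ?_
    ext f
    obtain ⟨a, rfl⟩ : ∃ a, f = t.adj.counit.app V ≫ a :=
      ⟨inv (t.adj.counit.app V) ≫ f, by simp⟩
    have h1 := t.transpose_counit_comp V a
    have h2 := t.transpose_ξ_comp V (inv a₀ ≫ a ≫ inv a₀)
    have hda : dd.dMap (inv a₀) = inv (dd.dMap a₀) := by
      refine IsIso.eq_inv_of_hom_inv_id ?_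
      rw [← dd.dMap_comp, IsIso.inv_hom_id, dd.dMap_id]
    have h3 : e (t.adj.counit.app V ≫ a) = t.ξ V ≫ (inv a₀ ≫ a ≫ inv a₀) ≫ dd.j V := by
      simp [e]
    change e (t.transpose (X := U) (t.adj.counit.app V ≫ a)) = t.transpose (e _)
    rw [h1, h3, h2]
    change t.ξ V ≫ (inv a₀ ≫ inv (t.adj.counit.app V) ≫
      (t.F.map (dd.j U ≫ dd.dMap a) ≫ t.ξ V) ≫ inv a₀) ≫ dd.j V = _
    simp only [Category.assoc]
    rw [reassoc_of% hinv, reassoc_of% hinv]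
    simp [dd.dMap_comp, hda, smul_smul, hs, U]
  unfold nuT
  rw [← hconj]
  exact (LinearMap.trace_conj' _ e).symm

end Indicator

section Simple

variable {k : Type w} [Field k] {C : Type u} [Category.{v} C] [Abelian C]
  [CategoryTheory.Linear k C] (dd : LinearDualityStruct k C)
  (t : TwistingAdjunction dd.toDualityStruct) [t.F.Additive] [t.F.Linear k]

lemma dMap_injective (hstrong : dd.toDualityStruct.IsStrong) {X Y : C} {f g : X ⟶ Y}
    (h : dd.dMap f = dd.dMap g) : f = g := by
  have := hstrong Y
  rw [← cancel_mono (dd.j Y), dd.j_natural, dd.j_natural, h]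

lemma isIso_of_isIso_dMap (hstrong : dd.toDualityStruct.IsStrong) {X Y : C} (f : X ⟶ Y)
    [IsIso (dd.dMap f)] : IsIso f := by
  have := hstrong X
  have := hstrong Y
  have := dd.isIso_dMap (dd.dMap f)
  have h := dd.j_natural f
  have : IsIso (f ≫ dd.j Y) := by rw [h]; infer_instance
  exact IsIso.of_isIso_comp_right f (dd.j Y)

/-- A strong duality preserves simple objects. -/
lemma simple_dObj (hstrong : dd.toDualityStruct.IsStrong) (X : C) [Simple X] :
    Simple (dd.dObj X) := by
  have := hstrong X
  refine ⟨fun {Y} f hf => ?_⟩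
  let g := dd.j X ≫ dd.dMap f
  have hepi : Epi g := by
    refine ⟨fun {Z} u w h => ?_⟩
    have h1 : dd.dMap f ≫ u = dd.dMap f ≫ w := by
      simpa [g, cancel_epi] using h
    have h2 := congrArg (fun q => dd.dMap q) h1
    simp only [dd.dMap_comp] at h2
    have h3 : ∀ q : dd.dObj Y ⟶ Z, (dd.dMap q ≫ dd.dMap (dd.dMap f)) =
        (dd.dMap q ≫ inv (dd.j Y) (I := hstrong Y)) ≫ f ≫ dd.j (dd.dObj X) := by
      intro q
      have := hstrong Y
      rw [dd.j_natural]
      simp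
    rw [h3, h3] at h2
    have := hstrong Y
    have := hstrong (dd.dObj X)
    exact dMap_injective dd hstrong (by simpa [cancel_mono] using h2)
  constructor
  · intro _ h0
    have : 𝟙 (dd.dObj X) = 0 := by
      rw [← IsIso.inv_hom_id f]
      exact (congrArg _ h0).trans comp_zero
    refine id_nonzero X (dMap_injective dd hstrong ?_)
    rw [dd.dMap_id, dMap_zero, this]
  · intro hne
    have hg : g ≠ 0 := by
      intro h
      have h1 := dd.j_comp_dMap_j_comp_dMap f
      change dd.j Y ≫ dd.dMap g = f at h1
      rw [h, dMap_zero, comp_zero] at h1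
      exact hne h1.symm
    have : IsIso g := isIso_of_epi_of_nonzero hg
    have : IsIso (dd.dMap f) := IsIso.of_isIso_comp_left (dd.j X) (dd.dMap f)
    exact isIso_of_isIso_dMap dd hstrong f

lemma simple_map_of_isEquivalence (F : C ⥤ C) [F.IsEquivalence] (X : C) [Simple X] :
    Simple (F.obj X) := by
  refine ⟨fun {Y} f hf => ?_⟩
  obtain ⟨g, hg⟩ := F.map_surjective ((F.objObjPreimageIso Y).hom ≫ f)
  have : Mono (F.map g) := by rw [hg]; infer_instance
  have : Mono g := F.mono_of_mono_map this
  have h1 : IsIso f ↔ IsIso g := by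
    rw [← isIso_iff_of_reflects_iso g F, hg]
    exact ⟨fun _ => inferInstance, fun _ =>
      IsIso.of_isIso_comp_left (F.objObjPreimageIso Y).hom f⟩
  have h2 : f = 0 ↔ g = 0 := by
    rw [← F.map_eq_zero_iff (f := g), hg]
    simp
  rw [h1, Simple.mono_isIso_iff_nonzero, ne_eq, ne_eq, h2]

/-- For a simple object `V`, the indicators of `G(V)` and `V^∨` agree. -/
lemma nuT_G_of_simple (hstrong : dd.toDualityStruct.IsStrong) [t.F.IsEquivalence]
    (V : C) [Simple V] : nuT dd t (t.G.obj V) = nuT dd t (dd.dObj V) := by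
  have : t.G.IsEquivalence := t.adj.isEquivalence_right_of_isEquivalence_left
  have := t.isIso_ξ V
  have := hstrong V
  have := simple_map_of_isEquivalence t.G V
  have := simple_dObj dd hstrong (t.G.obj V)
  by_cases hex : ∃ a : V ⟶ dd.dObj (t.G.obj V), a ≠ 0
  · let S : (V ⟶ dd.dObj (t.G.obj V)) → (V ⟶ dd.dObj (t.G.obj V)) := fun a =>
      inv (t.adj.counit.app V) ≫ t.F.map (dd.j _ ≫ dd.dMap a) ≫ t.ξ V
    have hS : ∀ a, t.F.map (dd.j _ ≫ dd.dMap a) ≫ t.ξ V = t.adj.counit.app V ≫ S a :=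
      fun a => by simp [S]
    have hSS : ∀ a, S (S a) = a := by
      intro a
      have h := t.transpose_transpose (X := t.G.obj V) (t.adj.counit.app V ≫ a)
      rw [t.transpose_counit_comp, hS, t.transpose_counit_comp, hS] at h
      exact (cancel_epi _).1 h
    have hadd : ∀ a b, S (a + b) = S a + S b := by
      intro a b
      simp [S, dd.dMap_add]
    by_cases hsym : ∃ a, a + S a ≠ 0
    · obtain ⟨a, ha⟩ := hsym
      have : IsIso (a + S a) := isIso_of_hom_simple ha
      refine nuT_G_eq_of_eigenvector dd t hstrong V (a + S a) 1 (one_mul 1) ?_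
      rw [hS, hadd, hSS, one_smul, add_comm]
    · push Not at hsym
      obtain ⟨a, ha⟩ := hex
      have : IsIso a := isIso_of_hom_simple ha
      refine nuT_G_eq_of_eigenvector dd t hstrong V a (-1) (by simp) ?_
      rw [hS, eq_neg_of_add_eq_zero_right (hsym a)]
      simp
  · push Not at hex
    have hrev : ∀ b : dd.dObj (t.G.obj V) ⟶ V, b = 0 := by
      intro b
      by_contra hb
      have : IsIso b := isIso_of_hom_simple hb
      apply id_nonzero V
      rw [← IsIso.inv_hom_id b, hex (inv b), zero_comp]
    have h1 : Subsingleton (t.F.obj (t.G.obj V) ⟶ dd.dObj (t.G.obj V)) :=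
      subsingleton_of_forall_eq 0 fun f => by
        have h := hex (inv (t.adj.counit.app V) ≫ f)
        rw [← IsIso.hom_inv_id_assoc (t.adj.counit.app V) f]
        exact (congrArg _ h).trans comp_zero
    have h2 : Subsingleton (t.F.obj (dd.dObj V) ⟶ dd.dObj (dd.dObj V)) :=
      subsingleton_of_forall_eq 0 fun f => by
        have h := hrev (inv (t.ξ V) ≫ f ≫ inv (dd.j V))
        have h' : f = t.ξ V ≫ (inv (t.ξ V) ≫ f ≫ inv (dd.j V)) ≫ dd.j V := by simp
        rw [h', h, zero_comp, comp_zero]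
    unfold nuT
    rw [Subsingleton.elim (twTransHom dd t (t.G.obj V)) 0,
      Subsingleton.elim (twTransHom dd t (dd.dObj V)) 0, map_zero, map_zero]

/-- For a finite biproduct `X` of simple objects, the indicators of `G(X)` and `X^∨` agree. -/
lemma nuT_G_of_isFiniteBiproductOfSimples [∀ X Y : C, FiniteDimensional k (X ⟶ Y)]
    (hstrong : dd.toDualityStruct.IsStrong) [t.F.IsEquivalence] (X : C)
    (hX : IsFiniteBiproductOfSimples X) :
    nuT dd t (t.G.obj X) = nuT dd t (dd.dObj X) := by
  obtain ⟨n, V, hV, ⟨e⟩⟩ := hX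
  have : t.G.Additive := t.adj.right_adjoint_additive
  let i : ∀ a, V a ⟶ X := fun a => biproduct.ι V a ≫ e.inv
  let p : ∀ a, X ⟶ V a := fun a => e.hom ≫ biproduct.π V a
  have hip : ∀ a, i a ≫ p a = 𝟙 (V a) := fun a => by simp [i, p]
  have hne : ∀ a b, a ≠ b → i a ≫ p b = 0 := fun a b hab => by
    simp [i, p, biproduct.ι_π_ne V hab]
  have hsum : ∑ a, p a ≫ i a = 𝟙 X := by
    have h : ∀ a, p a ≫ i a = e.hom ≫ (biproduct.π V a ≫ biproduct.ι V a) ≫ e.inv :=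
      fun a => by simp [i, p]
    simp only [h, ← Preadditive.comp_sum, ← Preadditive.sum_comp, biproduct.total,
      Category.id_comp, e.hom_inv_id]
  rw [nuT_eq_sum dd t (fun a => t.G.obj (V a)) (fun a => t.G.map (i a))
      (fun a => t.G.map (p a)) (fun a => by rw [← t.G.map_comp, hip, t.G.map_id])
      (fun a b hab => by rw [← t.G.map_comp, hne a b hab, t.G.map_zero])
      (by simp only [← t.G.map_comp, ← t.G.map_sum, hsum, t.G.map_id]),
    nuT_eq_sum dd t (fun a => dd.dObj (V a)) (fun a => dd.dMap (p a))
      (fun a => dd.dMap (i a)) (fun a => by rw [← dd.dMap_comp, hip, dd.dMap_id])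
      (fun a b hab => by rw [← dd.dMap_comp, hne b a hab.symm, dMap_zero])
      (by simp only [← dd.dMap_comp, ← dMap_sum, hsum, dd.dMap_id])]
  exact Finset.sum_congr rfl fun a _ =>
    have := hV a
    nuT_G_of_simple dd t hstrong (V a)

/-- If `X` is absolutely simple and `F(X) ≅ X^∨`, then `ν(X) = ±1`. -/
lemma nuT_eq_one_or_neg_one_of_iso [∀ X Y : C, FiniteDimensional k (X ⟶ Y)]
    [t.F.IsEquivalence] {X : C} (hX : IsAbsolutelySimple k X)
    (e : t.F.obj X ≅ dd.dObj X) :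
    nuT dd t X = 1 ∨ nuT dd t X = -1 := by
  obtain ⟨hs, hbij⟩ := hX
  have hspan : ∀ f : t.F.obj X ⟶ dd.dObj X, ∃ c : k, c • e.hom = f := by
    intro f
    obtain ⟨g, hg⟩ := t.F.map_surjective (f ≫ e.inv)
    obtain ⟨c, hc⟩ := hbij.2 g
    refine ⟨c, ?_⟩
    have h : t.F.map (c • 𝟙 X) = f ≫ e.inv := by rw [← hg]; exact congrArg _ hc
    rw [t.F.map_smul, t.F.map_id] at h
    have h' := congrArg (fun q => q ≫ e.hom) h
    simpa using h'
  have he : e.hom ≠ 0 := by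
    intro h
    have h1 : t.F.map (𝟙 X) = t.F.map 0 := by
      rw [t.F.map_id, t.F.map_zero, ← e.hom_inv_id, h, zero_comp]
    exact id_nonzero X (t.F.map_injective h1)
  have hrank : Module.finrank k (t.F.obj X ⟶ dd.dObj X) = 1 :=
    finrank_eq_one_iff'.2 ⟨e.hom, he, hspan⟩
  obtain ⟨c, hc⟩ := hspan (twTransHom dd t X e.hom)
  have hT : twTransHom dd t X = c • LinearMap.id := by
    ext f
    obtain ⟨d, rfl⟩ := hspan f
    rw [map_smul, ← hc, LinearMap.smul_apply, LinearMap.id_apply, smul_comm]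
  have hnu : nuT dd t X = c := by
    unfold nuT
    rw [hT, map_smul, LinearMap.trace_id, hrank]
    simp
  have hcc : (c * c) • e.hom = (1 : k) • e.hom := by
    have h := t.transpose_transpose e.hom
    rw [← twTransHom_apply dd t, ← twTransHom_apply dd t, hT] at h
    simpa [smul_smul] using h
  rw [hnu]
  exact mul_self_eq_one_iff.1 (smul_left_injective k he hcc)

/-- If `X` is simple and `F(X)` is not isomorphic to `X^∨`, then `ν(X) = 0`. -/
lemma nuT_eq_zero_of_not_iso (hstrong : dd.toDualityStruct.IsStrong) [t.F.IsEquivalence]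
    (X : C) [Simple X] (h : ¬ Nonempty (t.F.obj X ≅ dd.dObj X)) : nuT dd t X = 0 := by
  have := simple_map_of_isEquivalence t.F X
  have := simple_dObj dd hstrong X
  have : Subsingleton (t.F.obj X ⟶ dd.dObj X) :=
    subsingleton_of_forall_eq 0 fun f => by
      by_contra hf
      have : IsIso f := isIso_of_hom_simple hf
      exact h ⟨asIso f⟩
  unfold nuT
  rw [Subsingleton.elim (twTransHom dd t X) 0, map_zero]

end Simple

end TwistingAdjunction

/-- Twisted FS indicators of a `k`-linear twisting adjunction `t = (F, G, η, ε, ξ)` with `F`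
an equivalence, on an Abelian category with strong duality over `k`:
(a) if `X` is a finite biproduct of simple objects then `ν^t(G(X)) = ν^t(X^∨)`;
(b) if `X` is absolutely simple and `char k ≠ 2`, then `ν^t(X) ∈ {0, +1, −1}` and
`ν^t(X) ≠ 0` iff `F(X) ≅ X^∨`. -/
theorem twisted_nu_properties
    {k : Type w} [Field k] {C : Type u} [Category.{v} C] [Abelian C]
    [CategoryTheory.Linear k C] [∀ X Y : C, FiniteDimensional k (X ⟶ Y)]
    (dd : LinearDualityStruct k C) (hstrong : dd.toDualityStruct.IsStrong)
    (t : TwistingAdjunction dd.toDualityStruct) [t.F.Additive] [t.F.Linear k]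
    [t.F.IsEquivalence] :
    -- (a)
    (∀ X : C, IsFiniteBiproductOfSimples X →
      nuT dd t (t.G.obj X) = nuT dd t (dd.dObj X)) ∧
    -- (b)
    (ringChar k ≠ 2 → ∀ X : C, IsAbsolutelySimple k X →
      (nuT dd t X = 0 ∨ nuT dd t X = 1 ∨ nuT dd t X = -1) ∧
        (nuT dd t X ≠ 0 ↔ Nonempty (t.F.obj X ≅ dd.dObj X))) := by

  refine ⟨fun X hX => t.nuT_G_of_isFiniteBiproductOfSimples dd hstrong X hX, fun _ X hX => ?_⟩
  have := hX.1
  by_cases h : Nonempty (t.F.obj X ≅ dd.dObj X)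
  · have hnu := TwistingAdjunction.nuT_eq_one_or_neg_one_of_iso dd t hX h.some
    refine ⟨Or.inr hnu, fun _ => h, fun _ => ?_⟩
    rcases hnu with hnu | hnu <;> rw [hnu] <;> simp
  · have hnu := TwistingAdjunction.nuT_eq_zero_of_not_iso dd t hstrong X h
    exact ⟨Or.inl hnu, fun h0 => absurd hnu h0, fun h' => absurd h' h⟩
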